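/- Let d ≥ 2 and p > d, and set β := 2(p - d) and α := (d - p)/(p - 1) (so α < 0). Let 0 < R < R', and let v ∈ C¹(B_{R'} \ {0}) satisfy ∫ ‖x‖^β ‖∇v(x)‖^{p-2} ⟨∇v(x), ∇φ(x)⟩ dx = 0 for every smooth compactly supported φ : B_{R'} \ {0} → ℝ. Assume that lim_{x → 0} v(x) = +∞, that v > 0 on B_δ \ {0} for some δ ∈ (0, R), and that v(x) < 0 for every x with ‖x‖ = R. Then there exist ε ∈ (0, R) and C ≥ 1 such that C^{-1} ‖x‖^α ≤ v(x) ≤ C ‖x‖^α for all 0 < ‖x‖ < ε. -/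

import Mathlib

open MeasureTheory Metric Filter Topology Set
open scoped RealInnerProductSpace

noncomputable section

section Divergence

/-- Strict monotonicity of `a ↦ ‖a‖ ^ (p - 2) • a`. -/
lemma inner_rpow_smul_sub_pos {E : Type*} [NormedAddCommGroup E] [InnerProductSpace ℝ E]
    {p : ℝ} (hp : 2 < p) {a b : E} (hab : a ≠ b) :
    0 < ⟪‖a‖ ^ (p - 2) • a - ‖b‖ ^ (p - 2) • b, a - b⟫ := by
  have hq : 0 < p - 2 := by linarith
  set s := ‖a‖ ^ (p - 2) with hs
  set t := ‖b‖ ^ (p - 2) with ht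
  have hs0 : 0 ≤ s := by positivity
  have ht0 : 0 ≤ t := by positivity
  have e : ⟪s • a - t • b, a - b⟫ =
      1 / 2 * ((s + t) * ‖a - b‖ ^ 2) + 1 / 2 * ((s - t) * (‖a‖ ^ 2 - ‖b‖ ^ 2)) := by
    rw [norm_sub_sq_real]
    simp only [inner_sub_left, inner_sub_right, real_inner_smul_left, real_inner_self_eq_norm_sq,
      real_inner_comm a b]
    ring
  have hst : 0 < s + t := by
    rcases eq_or_ne a 0 with rfl | ha
    · have : 0 < t := Real.rpow_pos_of_pos (norm_pos_iff.2 hab.symm) _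
      linarith
    · have : 0 < s := Real.rpow_pos_of_pos (norm_pos_iff.2 ha) _
      linarith
  have h1 : 0 < ‖a - b‖ := norm_pos_iff.2 (sub_ne_zero.2 hab)
  have h2 : 0 ≤ (s - t) * (‖a‖ ^ 2 - ‖b‖ ^ 2) := by
    rcases le_total ‖a‖ ‖b‖ with h | h
    · have := Real.rpow_le_rpow (norm_nonneg _) h hq.le
      have := pow_le_pow_left₀ (norm_nonneg _) h 2
      exact mul_nonneg_of_nonpos_of_nonpos (by linarith) (by linarith)
    · have := Real.rpow_le_rpow (norm_nonneg _) h hq.le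
      have := pow_le_pow_left₀ (norm_nonneg _) h 2
      exact mul_nonneg (by linarith) (by linarith)
  rw [e]
  positivity

variable {E : Type*} [NormedAddCommGroup E] [InnerProductSpace ℝ E] [FiniteDimensional ℝ E]
  [MeasurableSpace E] [BorelSpace E]

/-- A function that is continuous on a neighbourhood of the compact support of the other factor
gives an integrable pairing. -/
lemma integrable_clm_apply_of_tsupport_subset {Ω : Set E} (hΩ : IsOpen Ω) {A : E → E}
    (hA : ContinuousOn A Ω) {L : E → E →L[ℝ] ℝ} (hL : Continuous L) (hLc : HasCompactSupport L)
    (hLs : tsupport L ⊆ Ω) : Integrable fun x ↦ L x (A x) := by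
  have hs : (tsupport fun x ↦ L x (A x)) ⊆ tsupport L := by
    refine closure_mono fun x hx hx' ↦ hx ?_
    simp [hx']
  refine Continuous.integrable_of_hasCompactSupport ?_
    (hLc.of_isClosed_subset (isClosed_tsupport _) hs)
  refine continuous_of_tsupport fun x hx ↦ ?_
  exact hL.continuousAt.clm_apply (hA.continuousAt (hΩ.mem_nhds (hLs (hs hx))))

/-- A continuous vector field which is weakly divergence free against smooth test functions is so
against `C¹` test functions. -/
lemma integral_fderiv_apply_eq_zero_of_contDiff_one {Ω : Set E} (hΩ : IsOpen Ω) {A : E → E}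
    (hA : ContinuousOn A Ω)
    (h : ∀ φ : E → ℝ, ContDiff ℝ (⊤ : ℕ∞) φ → HasCompactSupport φ → tsupport φ ⊆ Ω →
      ∫ x, fderiv ℝ φ x (A x) = 0)
    {φ : E → ℝ} (hφ : ContDiff ℝ 1 φ) (hc : HasCompactSupport φ) (hs : tsupport φ ⊆ Ω) :
    ∫ x, fderiv ℝ φ x (A x) = 0 := by
  obtain ⟨r, hr, hrΩ⟩ := hc.isCompact.exists_cthickening_subset_open hΩ hs
  set K := cthickening r (tsupport φ) with hK
  have hKc : IsCompact K := hc.isCompact.cthickening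
  obtain ⟨M, hM⟩ := hKc.exists_bound_of_continuousOn (hA.mono hrΩ)
  have hφ' : Continuous (fderiv ℝ φ) := hφ.continuous_fderiv one_ne_zero
  have huc : UniformContinuous (fderiv ℝ φ) := (hc.fderiv ℝ).uniformContinuous_of_continuous hφ'
  have hφK : tsupport (fderiv ℝ φ) ⊆ K :=
    (tsupport_fderiv_subset ℝ).trans (self_subset_cthickening _)
  have key : ∀ η > 0, ‖∫ x, fderiv ℝ φ x (A x)‖ ≤ η * M * volume.real K := by
    intro η hη
    obtain ⟨δ, hδ, hδη⟩ := Metric.uniformContinuous_iff.1 huc η hη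
    have hm : 0 < min δ r := lt_min hδ hr
    let b : ContDiffBump (0 : E) := ⟨min δ r / 2, min δ r, by positivity, by linarith⟩
    let ψ : E → ℝ := convolution (b.normed volume) φ (ContinuousLinearMap.lsmul ℝ ℝ) volume
    have hψs : ContDiff ℝ (⊤ : ℕ∞) ψ :=
      b.hasCompactSupport_normed.contDiff_convolution_left _ b.contDiff_normed
        hφ.continuous.locallyIntegrable
    have hψK : tsupport ψ ⊆ K := by
      refine closure_minimal ?_ isClosed_cthickening
      refine (support_convolution_subset _).trans ?_
      rw [b.support_normed_eq]
      rintro _ ⟨x, hx, z, hz, rfl⟩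
      refine mem_cthickening_of_dist_le _ z _ _ (subset_tsupport _ hz) ?_
      have : ‖x‖ < min δ r := by simpa [b] using hx
      simpa [dist_eq_norm] using (this.le.trans (min_le_right _ _))
    have hψc : HasCompactSupport ψ := hKc.of_isClosed_subset (isClosed_tsupport _) hψK
    have hψ' : ∀ x, ‖fderiv ℝ φ x - fderiv ℝ ψ x‖ ≤ η := by
      intro x
      have h1 := (hc.hasFDerivAt_convolution_right (ContinuousLinearMap.lsmul ℝ ℝ)
        (b.continuous_normed (μ := volume)).locallyIntegrable hφ x (μ := volume)).fderiv
      have h2 : dist ((convolution (b.normed volume) (fderiv ℝ φ)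
          (ContinuousLinearMap.lsmul ℝ ℝ) volume) x) (fderiv ℝ φ x) ≤ η :=
        b.dist_normed_convolution_le hφ'.aestronglyMeasurable fun z hz ↦
          (hδη (lt_of_lt_of_le hz (min_le_left _ _))).le
      rw [dist_comm, dist_eq_norm] at h2
      rw [h1]
      exact h2
    have hψ0 := h ψ hψs hψc (hψK.trans hrΩ)
    have hI1 : Integrable fun x ↦ fderiv ℝ φ x (A x) :=
      integrable_clm_apply_of_tsupport_subset hΩ hA hφ' (hc.fderiv ℝ) (hφK.trans hrΩ)
    have hψ'K : tsupport (fderiv ℝ ψ) ⊆ K := (tsupport_fderiv_subset ℝ).trans hψK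
    have hI2 : Integrable fun x ↦ fderiv ℝ ψ x (A x) :=
      integrable_clm_apply_of_tsupport_subset hΩ hA (hψs.continuous_fderiv (by simp))
        (hψc.fderiv ℝ) (hψ'K.trans hrΩ)
    have e1 : ∫ x, fderiv ℝ φ x (A x) = ∫ x in K, (fderiv ℝ φ x - fderiv ℝ ψ x) (A x) := by
      rw [setIntegral_eq_integral_of_forall_compl_eq_zero]
      · simp only [sub_apply]
        rw [integral_sub hI1 hI2, hψ0, sub_zero]
      · intro x hx
        rw [image_eq_zero_of_notMem_tsupport fun h ↦ hx (hφK h),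
          image_eq_zero_of_notMem_tsupport fun h ↦ hx (hψ'K h)]
        simp
    rw [e1]
    refine norm_setIntegral_le_of_norm_le_const hKc.measure_lt_top fun x hx ↦ ?_
    exact (ContinuousLinearMap.le_opNorm _ _).trans
      (mul_le_mul (hψ' x) (hM x hx) (norm_nonneg _) hη.le)
  have hlim : Tendsto (fun η : ℝ ↦ η * M * volume.real K) (𝓝[>] 0) (𝓝 0) := by
    have : Tendsto (fun η : ℝ ↦ η * M * volume.real K) (𝓝 0) (𝓝 (0 * M * volume.real K)) :=
      Continuous.tendsto (by fun_prop) 0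
    simpa using this.mono_left nhdsWithin_le_nhds
  exact norm_le_zero_iff.1 (ge_of_tendsto hlim (eventually_mem_nhdsWithin.mono key))

/-- Divergence of the radial-type field `g(x) (x - y)`, tested against `φ`. -/
lemma integral_fderiv_smul_sub {Ω : Set E} (hΩ : IsOpen Ω) {g : E → ℝ} (hg : ContDiffOn ℝ 1 g Ω)
    (y : E) {φ : E → ℝ} (hφ : ContDiff ℝ 1 φ) (hc : HasCompactSupport φ) (hs : tsupport φ ⊆ Ω) :
    ∫ x, fderiv ℝ φ x (g x • (x - y)) =
      -∫ x, φ x * (Module.finrank ℝ E * g x + fderiv ℝ g x (x - y)) := by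
  set F : E → ℝ := fun x ↦ φ x * g x with hF
  have hFs : tsupport F ⊆ tsupport φ := tsupport_mul_subset_left
  have hFc : HasCompactSupport F := hc.of_isClosed_subset (isClosed_tsupport _) hFs
  have hFd : ContDiff ℝ 1 F := by
    refine contDiff_iff_contDiffAt.2 fun x ↦ ?_
    by_cases hx : x ∈ tsupport F
    swap
    · exact contDiffAt_const.congr_of_eventuallyEq (notMem_tsupport_iff_eventuallyEq.1 hx)
    exact hφ.contDiffAt.mul (hg.contDiffAt (hΩ.mem_nhds (hs (hFs hx))))
  have hF' : ∀ x, fderiv ℝ F x (x - y) =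
      fderiv ℝ φ x (g x • (x - y)) + φ x * fderiv ℝ g x (x - y) := by
    intro x
    by_cases hx : x ∈ tsupport φ
    · have h1 : DifferentiableAt ℝ g x :=
        (hg.contDiffAt (hΩ.mem_nhds (hs hx))).differentiableAt one_ne_zero
      rw [hF, fderiv_fun_mul (hφ.differentiable one_ne_zero x) h1]
      simp
      ring
    · rw [image_eq_zero_of_notMem_tsupport hx,
        image_eq_zero_of_notMem_tsupport fun h ↦ hx (tsupport_fderiv_subset ℝ h),
        image_eq_zero_of_notMem_tsupport fun h ↦ hx (hFs (tsupport_fderiv_subset ℝ h))]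
      simp
  have hFi : Integrable F := hFd.continuous.integrable_of_hasCompactSupport hFc
  have hFf : Continuous (fderiv ℝ F) := hFd.continuous_fderiv one_ne_zero
  let b := stdOrthonormalBasis ℝ E
  have hcoord : ∀ i, ∫ x, fderiv ℝ F x (b i) * ⟪b i, x - y⟫ = -∫ x, F x := by
    intro i
    have hd : ∀ x, fderiv ℝ (fun x ↦ ⟪b i, x - y⟫) x (b i) = 1 := by
      intro x
      have : HasFDerivAt (fun x ↦ ⟪b i, x - y⟫) (innerSL ℝ (b i)) x :=
        (innerSL ℝ (b i)).hasFDerivAt.comp x ((hasFDerivAt_id x).sub_const y)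
      rw [this.fderiv]
      simp
    have hdiff : Differentiable ℝ (fun x ↦ ⟪b i, x - y⟫) :=
      (differentiable_const _).inner ℝ (differentiable_id.sub_const y)
    have h := integral_mul_fderiv_eq_neg_fderiv_mul_of_integrable (μ := (volume : Measure E))
      (f := F) (g := fun x ↦ ⟪b i, x - y⟫) (v := b i) ?_ ?_ ?_
      (fun x _ ↦ hFd.differentiable one_ne_zero x) (fun x _ ↦ hdiff x)
    · simp only [hd, mul_one] at h
      linarith
    · refine Continuous.integrable_of_hasCompactSupport (by fun_prop) ?_
      exact ((hFc.fderiv_apply ℝ (b i))).mul_right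
    · simpa only [hd, mul_one] using hFi
    · exact Continuous.integrable_of_hasCompactSupport
        (hFd.continuous.mul hdiff.continuous) hFc.mul_right
  have hsum : ∫ x, fderiv ℝ F x (x - y) = -(Module.finrank ℝ E * ∫ x, F x) := by
    have : ∀ x, fderiv ℝ F x (x - y) = ∑ i, fderiv ℝ F x (b i) * ⟪b i, x - y⟫ := by
      intro x
      conv_lhs => rw [← b.sum_repr' (x - y)]
      simp [map_sum, mul_comm]
    simp_rw [this]
    rw [integral_finsetSum]
    · simp [hcoord]
    · intro i _
      refine Continuous.integrable_of_hasCompactSupport (by fun_prop) ?_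
      exact ((hFc.fderiv_apply ℝ (b i))).mul_right
  have hI1 : Integrable fun x ↦ fderiv ℝ F x (x - y) :=
    Continuous.integrable_of_hasCompactSupport (by fun_prop) <| by
      refine (hFc.fderiv ℝ).mono fun x hx hx' ↦ hx ?_
      simp [hx']
  have hI2 : Integrable fun x ↦ fderiv ℝ φ x (g x • (x - y)) := by
    refine integrable_clm_apply_of_tsupport_subset hΩ (A := fun x ↦ g x • (x - y))
      (hg.continuousOn.smul (by fun_prop)) (hφ.continuous_fderiv one_ne_zero) (hc.fderiv ℝ)
      ((tsupport_fderiv_subset ℝ).trans hs)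
  have e : ∀ x, φ x * (Module.finrank ℝ E * g x + fderiv ℝ g x (x - y)) =
      Module.finrank ℝ E * F x + (fderiv ℝ F x (x - y) - fderiv ℝ φ x (g x • (x - y))) := by
    intro x
    rw [hF' x, hF]
    ring
  simp_rw [e]
  have h3 := integral_add (hFi.const_mul (Module.finrank ℝ E : ℝ)) (hI1.sub hI2)
  simp only [Pi.sub_apply] at h3
  rw [h3, integral_sub hI1 hI2, integral_const_mul, hsum]
  ring

end Divergence

section Barrier

variable {E : Type*} [NormedAddCommGroup E] [InnerProductSpace ℝ E]

lemma hasDerivAt_max_zero_sq (t : ℝ) : HasDerivAt (fun t : ℝ ↦ max t 0 ^ 2) (2 * max t 0) t := by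
  rcases lt_trichotomy t 0 with ht | rfl | ht
  · rw [max_eq_right ht.le, mul_zero]
    refine (hasDerivAt_const t (0 : ℝ)).congr_of_eventuallyEq ?_
    filter_upwards [eventually_lt_nhds ht] with s hs
    simp [max_eq_right hs.le]
  · have h : (fun t : ℝ ↦ max t 0 ^ 2) =O[𝓝 0] fun t ↦ ‖t - 0‖ ^ 2 := by
      refine Asymptotics.IsBigO.of_bound 1 (Eventually.of_forall fun s ↦ ?_)
      rcases le_total s 0 with hs | hs
      · simp [max_eq_right hs]
        positivity
      · simp [max_eq_left hs]
    have := (h.hasFDerivAt one_lt_two).hasDerivAt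
    simpa using this
  · rw [max_eq_left ht.le]
    refine (by simpa using hasDerivAt_pow 2 t : HasDerivAt (fun s : ℝ ↦ s ^ 2) (2 * t) t)
      |>.congr_of_eventuallyEq ?_
    filter_upwards [eventually_gt_nhds ht] with s hs
    simp [max_eq_left hs.le]

lemma contDiff_max_zero_sq : ContDiff ℝ 1 (fun t : ℝ ↦ max t 0 ^ 2) := by
  refine contDiff_one_iff_deriv.2 ⟨fun t ↦ (hasDerivAt_max_zero_sq t).differentiableAt, ?_⟩
  rw [funext fun t ↦ (hasDerivAt_max_zero_sq t).deriv]
  fun_prop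

lemma hasFDerivAt_norm_sub_rpow {x y : E} (hxy : x ≠ y) (q : ℝ) :
    HasFDerivAt (fun x ↦ ‖x - y‖ ^ q) ((q * ‖x - y‖ ^ (q - 2)) • innerSL ℝ (x - y)) x := by
  have hpos : 0 < ‖x - y‖ := norm_pos_iff.2 (sub_ne_zero.2 hxy)
  have h0 : HasFDerivAt (fun x ↦ x - y) (ContinuousLinearMap.id ℝ E) x :=
    (hasFDerivAt_id x).sub_const y
  have h1 : HasFDerivAt (fun x ↦ ‖x - y‖ ^ 2) (2 • innerSL ℝ (x - y)) x :=
    h0.norm_sq.congr_fderiv (by ext; simp)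
  have h2 := h1.rpow_const (p := q / 2) (Or.inl (by positivity))
  have e : ∀ (r : ℝ) (z : E), (‖z - y‖ ^ 2) ^ r = ‖z - y‖ ^ (2 * r) := fun r z ↦ by
    rw [← Real.rpow_natCast, ← Real.rpow_mul (norm_nonneg _)]
    norm_num
  simp only [e] at h2
  convert h2 using 1
  · ext z
    congr 1
    ring
  · ext z
    simp only [smul_apply, smul_eq_mul, nsmul_eq_mul]
    rw [show 2 * (q / 2 - 1) = q - 2 by ring]
    simp
    ring

lemma contDiffAt_norm_sub_rpow {x y : E} (hxy : x ≠ y) (q : ℝ) :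
    ContDiffAt ℝ 1 (fun x ↦ ‖x - y‖ ^ q) x :=
  ((contDiffAt_id.sub contDiffAt_const).norm ℝ (sub_ne_zero.2 hxy)).rpow_const_of_ne
    (norm_ne_zero_iff.2 (sub_ne_zero.2 hxy))

end Barrier

section Comparison

variable {E : Type*} [NormedAddCommGroup E] [InnerProductSpace ℝ E] [FiniteDimensional ℝ E]

lemma fderiv_apply_eq_inner_gradient (u : E → ℝ) (x z : E) :
    fderiv ℝ u x z = ⟪gradient u x, z⟫ := by
  simp [gradient]

lemma ContDiffOn.continuousOn_gradient {D : Set E} (hD : IsOpen D) {u : E → ℝ}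
    (hu : ContDiffOn ℝ 1 u D) : ContinuousOn (gradient u) D :=
  (InnerProductSpace.toDual ℝ E).symm.continuous.comp_continuousOn
    (hu.continuousOn_fderiv_of_isOpen hD le_rfl)

/-- The flux `‖x‖ ^ β ‖∇u‖ ^ (p - 2) ∇u` of the weighted `p`-Laplace operator. -/
def weightedFlux (p β : ℝ) (u : E → ℝ) (x : E) : E :=
  (‖x‖ ^ β * ‖gradient u x‖ ^ (p - 2)) • gradient u x

lemma continuousOn_weightedFlux {p β : ℝ} (hp : 2 < p) {D : Set E} (hD : IsOpen D)
    (h0 : (0 : E) ∉ D) {u : E → ℝ} (hu : ContDiffOn ℝ 1 u D) :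
    ContinuousOn (weightedFlux p β u) D := by
  have hg := hu.continuousOn_gradient hD
  refine ContinuousOn.smul (ContinuousOn.mul ?_ ?_) hg
  · exact continuousOn_id.norm.rpow_const fun x hx ↦
      Or.inl (norm_ne_zero_iff.2 (ne_of_mem_of_not_mem hx h0))
  · exact hg.norm.rpow_const fun x _ ↦ Or.inr (by linarith)

/-- The gradient of the barrier `A + B ‖x - y‖ ^ γ`. -/
lemma gradient_barrier {x y : E} (hxy : x ≠ y) (A B γ : ℝ) :
    gradient (fun x ↦ A + B * ‖x - y‖ ^ γ) x = (B * γ * ‖x - y‖ ^ (γ - 2)) • (x - y) := by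
  have h := ((hasFDerivAt_norm_sub_rpow hxy γ).const_mul B).const_add A
  refine HasGradientAt.gradient ?_
  rw [hasGradientAt_iff_hasFDerivAt]
  refine h.congr_fderiv ?_
  ext z
  simp [mul_assoc]

lemma weightedFlux_barrier {x y : E} (hxy : x ≠ y) (p β A B γ : ℝ) :
    weightedFlux p β (fun x ↦ A + B * ‖x - y‖ ^ γ) x =
      (B * γ * |B * γ| ^ (p - 2)) • ((‖x‖ ^ β * ‖x - y‖ ^ ((γ - 1) * (p - 1) - 1)) • (x - y)) := by
  have hpos : 0 < ‖x - y‖ := norm_pos_iff.2 (sub_ne_zero.2 hxy)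
  rw [weightedFlux, gradient_barrier hxy, smul_smul, smul_smul]
  congr 1
  have h1 : ‖(B * γ * ‖x - y‖ ^ (γ - 2)) • (x - y)‖ = |B * γ| * ‖x - y‖ ^ (γ - 1) := by
    rw [norm_smul, norm_mul, Real.norm_eq_abs, Real.norm_eq_abs,
      abs_of_pos (Real.rpow_pos_of_pos hpos _), mul_assoc, ← Real.rpow_add_one hpos.ne']
    congr 2
    ring
  rw [h1, Real.mul_rpow (abs_nonneg _) (by positivity), ← Real.rpow_mul hpos.le]
  have h2 : ‖x - y‖ ^ ((γ - 1) * (p - 1) - 1) =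
      ‖x - y‖ ^ ((γ - 1) * (p - 2)) * ‖x - y‖ ^ (γ - 2) := by
    rw [← Real.rpow_add hpos]
    congr 1
    ring
  rw [h2]
  ring

variable [MeasurableSpace E] [BorelSpace E]

/-- The weak form of the weighted `p`-Laplace operator on the barrier `A + B ‖x - y‖ ^ γ`. -/
lemma integral_fderiv_weightedFlux_barrier {D : Set E} (hD : IsOpen D) (h0 : (0 : E) ∉ D) {y : E}
    (hy : y ∉ D) (p β A B γ : ℝ) {φ : E → ℝ} (hφ : ContDiff ℝ 1 φ) (hc : HasCompactSupport φ)
    (hs : tsupport φ ⊆ D) :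
    ∫ x, fderiv ℝ φ x (weightedFlux p β (fun x ↦ A + B * ‖x - y‖ ^ γ) x) =
      -(B * γ * |B * γ| ^ (p - 2)) * ∫ x, φ x * (‖x‖ ^ β * ‖x - y‖ ^ ((γ - 1) * (p - 1) - 1) *
        (Module.finrank ℝ E + ((γ - 1) * (p - 1) - 1) + β * ⟪x, x - y⟫ / ‖x‖ ^ 2)) := by
  set q := (γ - 1) * (p - 1) - 1 with hq
  set c := B * γ * |B * γ| ^ (p - 2) with hcdef
  set g : E → ℝ := fun x ↦ ‖x‖ ^ β * ‖x - y‖ ^ q with hgdef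
  have hgd : ContDiffOn ℝ 1 g D := fun x hx ↦ by
    have h1 := contDiffAt_norm_sub_rpow (ne_of_mem_of_not_mem hx h0) β
    simp only [sub_zero] at h1
    exact (h1.mul (contDiffAt_norm_sub_rpow (ne_of_mem_of_not_mem hx hy) q)).contDiffWithinAt
  have e1 : ∀ x, fderiv ℝ φ x (weightedFlux p β (fun x ↦ A + B * ‖x - y‖ ^ γ) x) =
      c * fderiv ℝ φ x (g x • (x - y)) := by
    intro x
    by_cases hx : x ∈ tsupport φ
    · rw [weightedFlux_barrier (ne_of_mem_of_not_mem (hs hx) hy), map_smul, smul_eq_mul]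
    · rw [image_eq_zero_of_notMem_tsupport fun h ↦ hx (tsupport_fderiv_subset ℝ h)]
      simp
  have e2 : ∀ x, φ x * (Module.finrank ℝ E * g x + fderiv ℝ g x (x - y)) =
      φ x * (‖x‖ ^ β * ‖x - y‖ ^ q * (Module.finrank ℝ E + q + β * ⟪x, x - y⟫ / ‖x‖ ^ 2)) := by
    intro x
    by_cases hx : x ∈ tsupport φ
    · have hx0 : x ≠ 0 := ne_of_mem_of_not_mem (hs hx) h0
      have hxy : x ≠ y := ne_of_mem_of_not_mem (hs hx) hy
      have hp0 : 0 < ‖x‖ := norm_pos_iff.2 hx0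
      have hpy : 0 < ‖x - y‖ := norm_pos_iff.2 (sub_ne_zero.2 hxy)
      have h1 := hasFDerivAt_norm_sub_rpow hx0 β
      simp only [sub_zero] at h1
      have h2 : HasFDerivAt g _ x := h1.mul (hasFDerivAt_norm_sub_rpow hxy q)
      rw [h2.fderiv]
      have h3 : ‖x‖ ^ (β - 2) = ‖x‖ ^ β / ‖x‖ ^ 2 := by
        rw [Real.rpow_sub hp0]
        norm_num
      have h4 : ‖x - y‖ ^ (q - 2) = ‖x - y‖ ^ q / ‖x - y‖ ^ 2 := by
        rw [Real.rpow_sub hpy]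
        norm_num
      simp only [add_apply, smul_apply, smul_eq_mul, innerSL_apply_apply,
        real_inner_self_eq_norm_sq, h3, h4, hgdef]
      field_simp
      ring
    · rw [image_eq_zero_of_notMem_tsupport hx]
      simp
  simp_rw [e1]
  rw [integral_const_mul, integral_fderiv_smul_sub hD hgd y hφ hc hs]
  simp_rw [e2]
  ring

/-- Comparison principle for the weighted `p`-Laplace operator. -/
lemma le_of_weightedFlux_le {p β : ℝ} (hp : 2 < p) {D : Set E} (hD : IsOpen D)
    (hDb : Bornology.IsBounded D) (h0 : (0 : E) ∉ D) {u w : E → ℝ} (hu : ContDiffOn ℝ 1 u D)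
    (hw : ContDiffOn ℝ 1 w D) (huc : ContinuousOn u (closure D)) (hwc : ContinuousOn w (closure D))
    (hlt : ∀ x ∈ frontier D, u x < w x)
    (hint : ∀ φ : E → ℝ, ContDiff ℝ 1 φ → HasCompactSupport φ → tsupport φ ⊆ D → (∀ x, 0 ≤ φ x) →
      ∫ x, fderiv ℝ φ x (weightedFlux p β u x) ≤ ∫ x, fderiv ℝ φ x (weightedFlux p β w x)) :
    ∀ x ∈ D, u x ≤ w x := by
  set z : E → ℝ := fun x ↦ u x - w x with hz
  set φ : E → ℝ := D.indicator fun x ↦ max (z x) 0 ^ 2 with hφdef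
  set K : Set E := closure D ∩ z ⁻¹' Ici 0 with hK
  have hKclosed : IsClosed K :=
    (huc.sub hwc).preimage_isClosed_of_isClosed isClosed_closure isClosed_Ici
  have hKc : IsCompact K :=
    hDb.isCompact_closure.of_isClosed_subset hKclosed inter_subset_left
  have hKD : K ⊆ D := by
    rintro x ⟨hx, hx0⟩
    by_contra hxD
    have := hlt x ⟨hx, by rwa [hD.interior_eq]⟩
    simp only [hz, mem_preimage, mem_Ici] at hx0
    linarith
  have hφK : tsupport φ ⊆ K := by
    refine closure_minimal (fun x hx ↦ ?_) hKclosed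
    have hxD : x ∈ D := mem_of_indicator_ne_zero hx
    refine ⟨subset_closure hxD, ?_⟩
    by_contra hneg
    simp only [mem_preimage, mem_Ici, not_le] at hneg
    exact hx (by simp [hφdef, max_eq_right hneg.le])
  have hφc : HasCompactSupport φ := hKc.of_isClosed_subset (isClosed_tsupport _) hφK
  have hφev : ∀ x ∈ D, φ =ᶠ[𝓝 x] fun x ↦ max (z x) 0 ^ 2 := fun x hx ↦ by
    filter_upwards [hD.mem_nhds hx] with a ha
    simp [hφdef, ha]
  have hφd : ContDiff ℝ 1 φ := by
    refine contDiff_iff_contDiffAt.2 fun x ↦ ?_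
    by_cases hx : x ∈ tsupport φ
    · have hxD := hKD (hφK hx)
      refine ContDiffAt.congr_of_eventuallyEq ?_ (hφev x hxD)
      exact contDiff_max_zero_sq.contDiffAt.comp x
        ((hu.contDiffAt (hD.mem_nhds hxD)).sub (hw.contDiffAt (hD.mem_nhds hxD)))
    · exact contDiffAt_const.congr_of_eventuallyEq (notMem_tsupport_iff_eventuallyEq.1 hx)
  have hφ0 : ∀ x, 0 ≤ φ x := fun x ↦ indicator_nonneg (fun _ _ ↦ by positivity) x
  have hφ' : ∀ x ∈ D, ∀ a, fderiv ℝ φ x a =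
      2 * max (z x) 0 * ⟪a, gradient u x - gradient w x⟫ := by
    intro x hx a
    have h1 := ((hu.contDiffAt (hD.mem_nhds hx)).differentiableAt one_ne_zero).hasFDerivAt
    have h2 := ((hw.contDiffAt (hD.mem_nhds hx)).differentiableAt one_ne_zero).hasFDerivAt
    have h3 := (hasDerivAt_max_zero_sq (z x)).comp_hasFDerivAt x (h1.sub h2)
    have h4 := (h3.congr_of_eventuallyEq (hφev x hx)).fderiv
    rw [h4]
    simp only [smul_apply, sub_apply, smul_eq_mul,
      fderiv_apply_eq_inner_gradient, inner_sub_right, real_inner_comm a]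
  set I : E → ℝ := fun x ↦ fderiv ℝ φ x (weightedFlux p β u x - weightedFlux p β w x) with hI
  have hdiff : ∀ x, weightedFlux p β u x - weightedFlux p β w x = ‖x‖ ^ β •
      (‖gradient u x‖ ^ (p - 2) • gradient u x - ‖gradient w x‖ ^ (p - 2) • gradient w x) := by
    intro x
    simp only [weightedFlux, smul_sub, smul_smul]
  have hI_eq : ∀ x ∈ D, I x = 2 * max (z x) 0 * (‖x‖ ^ β *
      ⟪‖gradient u x‖ ^ (p - 2) • gradient u x - ‖gradient w x‖ ^ (p - 2) • gradient w x,
        gradient u x - gradient w x⟫) := by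
    intro x hx
    simp only [hI]
    rw [hdiff, hφ' x hx, real_inner_smul_left]
  have hφ'supp : tsupport (fderiv ℝ φ) ⊆ D :=
    (tsupport_fderiv_subset ℝ).trans (hφK.trans hKD)
  have hφ'out : ∀ x ∉ D, fderiv ℝ φ x = 0 := fun x hx ↦
    image_eq_zero_of_notMem_tsupport fun h ↦ hx (hφ'supp h)
  have hI0 : ∀ x, 0 ≤ I x := by
    intro x
    by_cases hx : x ∈ D
    · rw [hI_eq x hx]
      have : 0 ≤ ⟪‖gradient u x‖ ^ (p - 2) • gradient u x -
          ‖gradient w x‖ ^ (p - 2) • gradient w x, gradient u x - gradient w x⟫ := by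
        rcases eq_or_ne (gradient u x) (gradient w x) with h | h
        · simp [h]
        · exact (inner_rpow_smul_sub_pos hp h).le
      positivity
    · simp [hI, hφ'out x hx]
  have hφ'c : Continuous (fderiv ℝ φ) := hφd.continuous_fderiv one_ne_zero
  have hfu := continuousOn_weightedFlux (β := β) hp hD h0 hu
  have hfw := continuousOn_weightedFlux (β := β) hp hD h0 hw
  have hIc : Continuous I := by
    refine continuous_iff_continuousAt.2 fun x ↦ ?_
    by_cases hx : x ∈ tsupport (fderiv ℝ φ)
    · exact hφ'c.continuousAt.clm_apply
        ((hfu.sub hfw).continuousAt (hD.mem_nhds (hφ'supp hx)))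
    · refine continuousAt_const.congr (f := fun _ ↦ (0 : ℝ)) ?_
      filter_upwards [notMem_tsupport_iff_eventuallyEq.1 hx] with a ha
      simp [hI, ha]
  have hIi : Integrable I := integrable_clm_apply_of_tsupport_subset hD (hfu.sub hfw) hφ'c
    (hφc.fderiv ℝ) hφ'supp
  have hIint : ∫ x, I x = 0 := by
    refine le_antisymm ?_ (integral_nonneg hI0)
    have := hint φ hφd hφc (hφK.trans hKD) hφ0
    simp only [hI, map_sub]
    rw [integral_sub
      (integrable_clm_apply_of_tsupport_subset hD hfu hφ'c (hφc.fderiv ℝ) hφ'supp)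
      (integrable_clm_apply_of_tsupport_subset hD hfw hφ'c (hφc.fderiv ℝ) hφ'supp)]
    linarith
  have hIzero : I = 0 :=
    (hIc.ae_eq_iff_eq volume continuous_const).1 ((integral_eq_zero_iff_of_nonneg hI0 hIi).1 hIint)
  have hφ'zero : ∀ x, fderiv ℝ φ x = 0 := by
    intro x
    by_cases hx : x ∈ D
    · ext a
      rw [hφ' x hx]
      rcases le_or_gt (z x) 0 with h | h
      · simp [max_eq_right h]
      · have h1 := congrFun hIzero x
        rw [hI_eq x hx, max_eq_left h.le] at h1
        have hxn : 0 < ‖x‖ := norm_pos_iff.2 (ne_of_mem_of_not_mem hx h0)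
        have hg : gradient u x = gradient w x := by
          by_contra hne
          have := inner_rpow_smul_sub_pos hp hne
          have : 0 < 2 * z x * (‖x‖ ^ β *
            ⟪‖gradient u x‖ ^ (p - 2) • gradient u x - ‖gradient w x‖ ^ (p - 2) • gradient w x,
              gradient u x - gradient w x⟫) := by positivity
          simp only [Pi.zero_apply] at h1
          linarith
        simp [hg]
    · exact hφ'out x hx
  intro x hx
  have h1 := is_const_of_fderiv_eq_zero (𝕜 := ℝ) (hφd.differentiable one_ne_zero) hφ'zero x 0
  have h2 : φ 0 = 0 := by simp [hφdef, h0]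
  have h3 : max (z x) 0 ^ 2 = 0 := by
    rw [h2] at h1
    simpa [hφdef, hx] using h1
  have h4 := le_max_left (z x) 0
  rw [pow_eq_zero_iff two_ne_zero] at h3
  simp only [hz] at h4 h3
  linarith

end Comparison

lemma lower_bound_of_barrier_le {Λ V v₀ s g t B : ℝ} (hΛ : 0 < Λ) (hv : 0 < v₀) (hs : 0 < s)
    (hsg : s < g) (hgt : g < t) (hB : B * (t - s) = 2 * V / Λ) (h : v₀ ≤ B * (g - s)) :
    Λ / 2 * v₀ / g * t ≤ V := by
  have hg : 0 < g := hs.trans hsg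
  have hgs : 0 < g - s := sub_pos.2 hsg
  have h1 : v₀ * (t - s) ≤ 2 * V / Λ * (g - s) := by
    calc v₀ * (t - s) ≤ B * (g - s) * (t - s) := mul_le_mul_of_nonneg_right h (by linarith)
      _ = B * (t - s) * (g - s) := by ring
      _ = _ := by rw [hB]
  have h2 : t * (g - s) ≤ g * (t - s) := by nlinarith
  have h3 : v₀ * t * (g - s) ≤ 2 * V / Λ * g * (g - s) := by
    calc v₀ * t * (g - s) = v₀ * (t * (g - s)) := by ring
      _ ≤ v₀ * (g * (t - s)) := mul_le_mul_of_nonneg_left h2 hv.le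
      _ = g * (v₀ * (t - s)) := by ring
      _ ≤ g * (2 * V / Λ * (g - s)) := mul_le_mul_of_nonneg_left h1 hg.le
      _ = _ := by ring
  have h4 : v₀ * t ≤ 2 * V / Λ * g := le_of_mul_le_mul_right h3 hgs
  calc Λ / 2 * v₀ / g * t = Λ / 2 * (v₀ * t) / g := by ring
    _ ≤ Λ / 2 * (2 * V / Λ * g) / g := by gcongr
    _ = V := by field_simp

lemma upper_bound_of_barrier_le {Λ V v₀ s g t B : ℝ} (hΛ : 0 < Λ) (hv : 0 < v₀) (hs : 0 < s)
    (hsg : s < g) (hgt : g < t) (hB : B * (t - s) = Λ * V / 2) (h : B * (g - s) ≤ v₀) :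
    V ≤ 2 / Λ * v₀ / (g - s) * t := by
  have hgs : 0 < g - s := sub_pos.2 hsg
  have h1 : Λ * V / 2 * (g - s) ≤ v₀ * (t - s) := by
    calc Λ * V / 2 * (g - s) = B * (g - s) * (t - s) := by rw [← hB]; ring
      _ ≤ _ := mul_le_mul_of_nonneg_right h (by linarith)
  have h2 : Λ * V / 2 * (g - s) ≤ v₀ * t :=
    h1.trans (mul_le_mul_of_nonneg_left (by linarith) hv.le)
  calc V = 2 / Λ * (Λ * V / 2 * (g - s)) / (g - s) := by field_simp
    _ ≤ 2 / Λ * (v₀ * t) / (g - s) := by gcongr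
    _ = _ := by ring

section Harnack

variable {E : Type*} [NormedAddCommGroup E] [InnerProductSpace ℝ E]

/-- Some vector of any given length is orthogonal to `y` and makes a nonobtuse angle with `x`. -/
lemma exists_norm_eq_inner_eq_zero_inner_nonneg [FiniteDimensional ℝ E]
    (hE : 2 ≤ Module.finrank ℝ E) (x y : E) {r : ℝ} (hr : 0 ≤ r) :
    ∃ z : E, ‖z‖ = r ∧ ⟪y, z⟫ = 0 ∧ 0 ≤ ⟪z, x⟫ := by
  have h1 := (ℝ ∙ y).finrank_add_finrank_orthogonal
  have h2 : Module.finrank ℝ (ℝ ∙ y) ≤ 1 := (finrank_span_le_card {y}).trans (by simp)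
  have h3 : (ℝ ∙ y)ᗮ ≠ ⊥ := by
    intro h
    rw [h, finrank_bot] at h1
    omega
  obtain ⟨e, he, he0⟩ := Submodule.exists_mem_ne_zero_of_ne_bot h3
  have hye : ⟪y, e⟫ = 0 := Submodule.mem_orthogonal_singleton_iff_inner_right.1 he
  have hen : ‖e‖ ≠ 0 := norm_ne_zero_iff.2 he0
  have hn : ‖(r / ‖e‖) • e‖ = r := by
    rw [norm_smul, Real.norm_eq_abs, abs_of_nonneg (by positivity)]
    field_simp
  rcases le_total 0 ⟪(r / ‖e‖) • e, x⟫ with h | h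
  · exact ⟨(r / ‖e‖) • e, hn, by simp [real_inner_smul_right, hye], h⟩
  · refine ⟨-((r / ‖e‖) • e), by rw [norm_neg, hn], by simp [real_inner_smul_right, hye], ?_⟩
    rw [inner_neg_left]
    linarith

/-- Chaining a local Harnack inequality along a segment whose end points make a nonobtuse angle. -/
lemma harnack_of_inner_nonneg {v : E → ℝ} {κ δ : ℝ} (hκ : 0 ≤ κ)
    (hloc : ∀ x y : E, 0 < ‖y‖ → ‖y‖ < δ → ‖x - y‖ ≤ ‖y‖ / 10 → κ * v y ≤ v x)
    {x y : E} (hxy : ‖x‖ = ‖y‖) (hy0 : 0 < ‖y‖) (hyδ : ‖y‖ < δ) (hin : 0 ≤ ⟪x, y⟫) :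
    κ ^ 40 * v y ≤ v x := by
  set c : ℕ → E := fun k ↦ y + ((k : ℝ) / 40) • (x - y) with hc
  have hnorm : ∀ k : ℕ, k ≤ 40 → ‖y‖ / 2 ≤ ‖c k‖ ∧ ‖c k‖ ≤ ‖y‖ := by
    intro k hk
    set t : ℝ := (k : ℝ) / 40 with ht
    have ht0 : 0 ≤ t := by positivity
    have ht1 : t ≤ 1 := by
      have : (k : ℝ) ≤ 40 := by exact_mod_cast hk
      rw [ht]
      linarith
    have e : c k = (1 - t) • y + t • x := by
      simp only [hc]
      module
    have hsq : ‖c k‖ ^ 2 = (1 - t) ^ 2 * ‖y‖ ^ 2 + 2 * ((1 - t) * t * ⟪x, y⟫) + t ^ 2 * ‖y‖ ^ 2 := by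
      rw [e, norm_add_sq_real, norm_smul, norm_smul, real_inner_smul_left, real_inner_smul_right,
        real_inner_comm, mul_pow, mul_pow, hxy, Real.norm_eq_abs, Real.norm_eq_abs, sq_abs, sq_abs]
      ring
    have hle : ⟪x, y⟫ ≤ ‖y‖ ^ 2 := by
      have := real_inner_le_norm x y
      rw [hxy] at this
      linarith
    have htt : 0 ≤ (1 - t) * t := mul_nonneg (by linarith) ht0
    constructor
    · refine le_of_sq_le_sq ?_ (norm_nonneg _)
      rw [hsq]
      nlinarith [mul_nonneg htt hin, mul_nonneg (sq_nonneg (1 - 2 * t)) (sq_nonneg ‖y‖),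
        sq_nonneg ‖y‖]
    · refine le_of_sq_le_sq ?_ (norm_nonneg _)
      rw [hsq]
      nlinarith [mul_le_mul_of_nonneg_left hle htt]
  have hchain : ∀ k : ℕ, k ≤ 40 → κ ^ k * v y ≤ v (c k) := by
    intro k
    induction k with
    | zero => simp [hc]
    | succ k ih =>
      intro hk
      have h1 := ih (by omega)
      obtain ⟨h2, h3⟩ := hnorm k (by omega)
      have hstep : ‖c (k + 1) - c k‖ ≤ ‖c k‖ / 10 := by
        have e : c (k + 1) - c k = (1 / 40 : ℝ) • (x - y) := by
          simp only [hc]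
          push_cast
          module
        have : ‖x - y‖ ≤ 2 * ‖y‖ := (norm_sub_le x y).trans (by rw [hxy]; linarith)
        rw [e, norm_smul, Real.norm_eq_abs, abs_of_pos (by norm_num)]
        linarith
      have h4 := hloc (c (k + 1)) (c k) (by linarith) (by linarith) hstep
      calc κ ^ (k + 1) * v y = κ * (κ ^ k * v y) := by ring
        _ ≤ κ * v (c k) := mul_le_mul_of_nonneg_left h1 hκ
        _ ≤ _ := h4
  have := hchain 40 le_rfl
  have e : c 40 = x := by
    simp only [hc]
    norm_num
  rwa [e] at this

/-- Chaining a local Harnack inequality between points of the same sphere. -/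
lemma harnack_sphere [FiniteDimensional ℝ E] (hE : 2 ≤ Module.finrank ℝ E) {v : E → ℝ} {κ δ : ℝ}
    (hκ : 0 ≤ κ)
    (hloc : ∀ x y : E, 0 < ‖y‖ → ‖y‖ < δ → ‖x - y‖ ≤ ‖y‖ / 10 → κ * v y ≤ v x)
    {x y : E} (hxy : ‖x‖ = ‖y‖) (hy0 : 0 < ‖y‖) (hyδ : ‖y‖ < δ) :
    κ ^ 80 * v y ≤ v x := by
  obtain ⟨z, hz, hyz, hzx⟩ := exists_norm_eq_inner_eq_zero_inner_nonneg hE x y hy0.le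
  have h1 : κ ^ 40 * v y ≤ v z :=
    harnack_of_inner_nonneg hκ hloc hz hy0 hyδ (by rw [real_inner_comm, hyz])
  have h2 : κ ^ 40 * v z ≤ v x := harnack_of_inner_nonneg hκ hloc (hxy.trans hz.symm)
    (by rwa [hz]) (by rwa [hz]) (by rwa [real_inner_comm])
  calc κ ^ 80 * v y = κ ^ 40 * (κ ^ 40 * v y) := by ring
    _ ≤ κ ^ 40 * v z := mul_le_mul_of_nonneg_left h1 (by positivity)
    _ ≤ v x := h2

variable [FiniteDimensional ℝ E] [MeasurableSpace E] [BorelSpace E]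

/-- Weak solutions of `-div (‖x‖ ^ β ‖∇v‖ ^ (p - 2) ∇v) = 0`, tested against `C¹` functions. -/
def IsWeakSolution (p β : ℝ) (v : E → ℝ) (Ω : Set E) : Prop :=
  ∀ φ : E → ℝ, ContDiff ℝ 1 φ → HasCompactSupport φ → tsupport φ ⊆ Ω →
    ∫ x, fderiv ℝ φ x (weightedFlux p β v x) = 0

/-- Local Harnack inequality, by comparison with a cusp `a (1 - (‖x - y‖ / r) ^ γ)`. -/
lemma harnack_local {p : ℝ} (hE : 2 ≤ Module.finrank ℝ E) (hp : (Module.finrank ℝ E : ℝ) < p)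
    {Ω : Set E} {v : E → ℝ} (hv : ContDiffOn ℝ 1 v Ω)
    (hsol : IsWeakSolution p (2 * (p - Module.finrank ℝ E)) v Ω) {y : E} (hy : y ≠ 0)
    (hyΩ : closedBall y (‖y‖ / 5) ⊆ Ω) (hpos : ∀ x ∈ closedBall y (‖y‖ / 5), 0 < v x) {x : E}
    (hx : ‖x - y‖ ≤ ‖y‖ / 10) :
    (1 - (1 / 2) ^ ((p - Module.finrank ℝ E) / (2 * (p - 1)))) * v y ≤ v x := by
  set n : ℝ := (Module.finrank ℝ E : ℝ) with hn
  have hn2 : 2 ≤ n := by rw [hn]; exact_mod_cast hE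
  have hy0 : 0 < ‖y‖ := norm_pos_iff.2 hy
  set γ := (p - n) / (2 * (p - 1)) with hγ
  have hγ0 : 0 < γ := div_pos (by linarith) (by linarith)
  have hκ0 : 0 < (1 / 2 : ℝ) ^ γ := by positivity
  have hκ1 : (1 / 2 : ℝ) ^ γ < 1 := Real.rpow_lt_one (by norm_num) (by norm_num) hγ0
  set r := ‖y‖ / 5 with hr
  have hr0 : 0 < r := by positivity
  have hvy : 0 < v y := hpos y (mem_closedBall_self hr0.le)
  rcases eq_or_ne x y with rfl | hxy
  · nlinarith
  have key : ∀ a, 0 < a → a < v y → (1 - (1 / 2) ^ γ) * a ≤ v x := by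
    intro a ha hav
    set D : Set E := ball y r \ {y} with hD
    have hDo : IsOpen D := isOpen_ball.sdiff isClosed_singleton
    have hDcb : closure D ⊆ closedBall y r :=
      (closure_mono sdiff_subset).trans closure_ball_subset_closedBall
    have h0 : (0 : E) ∉ D := by
      rintro ⟨h, -⟩
      simp [hr] at h
      linarith
    have hyD : y ∉ D := fun h ↦ h.2 rfl
    have hDΩ : D ⊆ Ω := (subset_closure.trans hDcb).trans hyΩ
    set B := -a * r ^ (-γ) with hB
    set w : E → ℝ := fun x ↦ a + B * ‖x - y‖ ^ γ with hw
    have hrr : r ^ (-γ) * r ^ γ = 1 := by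
      rw [← Real.rpow_add hr0]
      simp
    have hcmp := le_of_weightedFlux_le (p := p) (β := 2 * (p - n)) (by linarith) hDo
      (isBounded_ball.subset sdiff_subset) h0 (u := w) (w := v) ?_ (hv.mono hDΩ) ?_
      (hv.continuousOn.mono (hDcb.trans hyΩ)) ?_ ?_ x ?_
    · have h1 : ‖x - y‖ ^ γ ≤ (r * (1 / 2)) ^ γ :=
        Real.rpow_le_rpow (norm_nonneg _) (by rw [hr]; linarith) hγ0.le
      rw [Real.mul_rpow hr0.le (by norm_num)] at h1
      have h2 : a * r ^ (-γ) * ‖x - y‖ ^ γ ≤ a * (1 / 2) ^ γ := by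
        calc a * r ^ (-γ) * ‖x - y‖ ^ γ ≤ a * r ^ (-γ) * (r ^ γ * (1 / 2) ^ γ) := by gcongr
          _ = a * (r ^ (-γ) * r ^ γ) * (1 / 2) ^ γ := by ring
          _ = _ := by rw [hrr, mul_one]
      simp only [hw, hB] at hcmp
      linarith
    · intro z hz
      exact (contDiffAt_const.add (contDiffAt_const.mul
        (contDiffAt_norm_sub_rpow (ne_of_mem_of_not_mem hz hyD) γ))).contDiffWithinAt
    · exact (continuous_const.add (continuous_const.mul
        ((continuous_id.sub continuous_const).norm.rpow_const fun _ ↦ Or.inr hγ0.le))).continuousOn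
    · rintro z ⟨hz, hzD⟩
      rw [hDo.interior_eq] at hzD
      rcases eq_or_ne z y with rfl | hzy
      · simpa [hw, Real.zero_rpow hγ0.ne'] using hav
      · have hzr : ‖z - y‖ = r := by
          have h1 : ‖z - y‖ ≤ r := by simpa [dist_eq_norm] using hDcb hz
          have h2 : z ∉ ball y r := fun h ↦ hzD ⟨h, hzy⟩
          simp only [mem_ball, dist_eq_norm, not_lt] at h2
          exact le_antisymm h1 h2
        have : w z = 0 := by
          simp only [hw, hB, hzr]
          linear_combination (-a) * hrr
        rw [this]
        exact hpos z (hDcb hz)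
    · intro φ hφ hc hs hφ0
      rw [hsol φ hφ hc (hs.trans hDΩ), hw, integral_fderiv_weightedFlux_barrier hDo h0 hyD _ _ _ _ _
        hφ hc hs]
      have hBγ : 0 ≤ -(B * γ * |B * γ| ^ (p - 2)) := by
        have : 0 ≤ a * r ^ (-γ) * γ * |B * γ| ^ (p - 2) := by positivity
        simp only [hB] at this ⊢
        linarith
      refine mul_nonpos_of_nonneg_of_nonpos hBγ (integral_nonpos fun z ↦ ?_)
      by_cases hz : z ∈ tsupport φ
      · have hzD := hs hz
        have hz0 : 0 < ‖z‖ := norm_pos_iff.2 (ne_of_mem_of_not_mem hzD h0)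
        have hzr : ‖z - y‖ ≤ r := by simpa [dist_eq_norm] using (mem_ball.1 hzD.1).le
        have hzy : ‖z - y‖ ≤ ‖z‖ / 4 := by
          have := norm_sub_norm_le y z
          rw [norm_sub_rev] at this
          rw [hr] at hzr
          linarith
        have hq : n + ((γ - 1) * (p - 1) - 1) = -(p - n) / 2 := by
          have : p - 1 ≠ 0 := by linarith
          rw [hγ]
          field_simp
          ring
        have hin : 2 * (p - n) * ⟪z, z - y⟫ / ‖z‖ ^ 2 ≤ (p - n) / 2 := by
          rw [div_le_iff₀ (by positivity)]
          have h1 : ⟪z, z - y⟫ ≤ ‖z‖ * (‖z‖ / 4) := (real_inner_le_norm _ _).trans (by gcongr)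
          nlinarith [mul_le_mul_of_nonneg_left h1 (by linarith : 0 ≤ p - n)]
        refine mul_nonpos_of_nonneg_of_nonpos (hφ0 z)
          (mul_nonpos_of_nonneg_of_nonpos (by positivity) ?_)
        rw [hq]
        linarith
      · simp [image_eq_zero_of_notMem_tsupport hz]
    · refine ⟨?_, hxy⟩
      rw [mem_ball, dist_eq_norm, hr]
      linarith
  have hlim : Tendsto (fun a ↦ (1 - (1 / 2 : ℝ) ^ γ) * a) (𝓝[<] v y)
      (𝓝 ((1 - (1 / 2 : ℝ) ^ γ) * v y)) :=
    (Continuous.tendsto (by fun_prop) _).mono_left nhdsWithin_le_nhds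
  refine le_of_tendsto hlim ?_
  filter_upwards [Ioo_mem_nhdsLT hvy] with a ha
  exact key a ha.1 ha.2

/-- Comparison with the radial solutions `A + B ‖x‖ ^ α` on an annulus. -/
lemma annulus_comparison {p : ℝ} (hE : 2 ≤ Module.finrank ℝ E)
    (hp : (Module.finrank ℝ E : ℝ) < p) {Ω : Set E} {v : E → ℝ} (hv : ContDiffOn ℝ 1 v Ω)
    (hsol : IsWeakSolution p (2 * (p - Module.finrank ℝ E)) v Ω) {a b : ℝ} (ha : 0 < a)
    (hab : ∀ x : E, a ≤ ‖x‖ → ‖x‖ ≤ b → x ∈ Ω) (A B : ℝ) {α : ℝ}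
    (hα : α = (Module.finrank ℝ E - p) / (p - 1)) :
    ((∀ x : E, ‖x‖ = a → A + B * a ^ α < v x) → (∀ x : E, ‖x‖ = b → A + B * b ^ α < v x) →
      ∀ x : E, a < ‖x‖ → ‖x‖ < b → A + B * ‖x‖ ^ α ≤ v x) ∧
    ((∀ x : E, ‖x‖ = a → v x < A + B * a ^ α) → (∀ x : E, ‖x‖ = b → v x < A + B * b ^ α) →
      ∀ x : E, a < ‖x‖ → ‖x‖ < b → v x ≤ A + B * ‖x‖ ^ α) := by
  have hn2 : (2 : ℝ) ≤ Module.finrank ℝ E := by exact_mod_cast hE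
  set D : Set E := {x | a < ‖x‖ ∧ ‖x‖ < b} with hD
  have hDo : IsOpen D :=
    (isOpen_lt continuous_const continuous_norm).inter (isOpen_lt continuous_norm continuous_const)
  have hDcl : closure D ⊆ {x | a ≤ ‖x‖ ∧ ‖x‖ ≤ b} :=
    closure_minimal (fun x hx ↦ ⟨hx.1.le, hx.2.le⟩) ((isClosed_le continuous_const
      continuous_norm).inter (isClosed_le continuous_norm continuous_const))
  have hDb : Bornology.IsBounded D :=
    (isBounded_ball (x := (0 : E)) (r := b)).subset fun x hx ↦ by simpa using hx.2
  have h0 : (0 : E) ∉ D := fun h ↦ by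
    have := h.1
    simp only [norm_zero] at this
    linarith
  have hclΩ : closure D ⊆ Ω := fun x hx ↦ hab x (hDcl hx).1 (hDcl hx).2
  have hDΩ : D ⊆ Ω := subset_closure.trans hclΩ
  have hfr : ∀ x ∈ frontier D, ‖x‖ = a ∨ ‖x‖ = b := by
    rintro x ⟨hx, hxD⟩
    rw [hDo.interior_eq] at hxD
    obtain ⟨h1, h2⟩ := hDcl hx
    by_contra! h
    exact hxD ⟨lt_of_le_of_ne h1 h.1.symm, lt_of_le_of_ne h2 h.2⟩
  set w : E → ℝ := fun x ↦ A + B * ‖x - 0‖ ^ α with hw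
  have hwd : ∀ x ∈ closure D, ContDiffAt ℝ 1 w x := fun x hx ↦ by
    have hx0 : x ≠ 0 := norm_pos_iff.1 (ha.trans_le (hDcl hx).1)
    exact contDiffAt_const.add (contDiffAt_const.mul (contDiffAt_norm_sub_rpow hx0 α))
  have hwD : ContDiffOn ℝ 1 w D := fun x hx ↦ (hwd x (subset_closure hx)).contDiffWithinAt
  have hwc : ContinuousOn w (closure D) :=
    fun x hx ↦ (hwd x hx).continuousAt.continuousWithinAt
  have hwsol : IsWeakSolution p (2 * (p - Module.finrank ℝ E)) w D := by
    intro φ hφ hc hs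
    rw [hw, integral_fderiv_weightedFlux_barrier hDo h0 h0 _ _ _ _ _ hφ hc hs]
    refine mul_eq_zero_of_right _ (integral_eq_zero_of_ae (Eventually.of_forall fun x ↦ ?_))
    by_cases hx : x ∈ tsupport φ
    · have hx0 : ‖x‖ ≠ 0 := norm_ne_zero_iff.2 (ne_of_mem_of_not_mem (hs hx) h0)
      have hp1 : p - 1 ≠ 0 := by linarith
      have e : (Module.finrank ℝ E : ℝ) + ((α - 1) * (p - 1) - 1) +
          2 * (p - Module.finrank ℝ E) * ⟪x, x - 0⟫ / ‖x‖ ^ 2 = 0 := by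
        rw [sub_zero, real_inner_self_eq_norm_sq, hα]
        field_simp
        ring
      simp only [e, mul_zero, Pi.zero_apply]
    · simp [image_eq_zero_of_notMem_tsupport hx]
  have hw' : ∀ x, w x = A + B * ‖x‖ ^ α := fun x ↦ by simp [hw]
  constructor
  · intro h1 h2 x hx1 hx2
    rw [← hw']
    refine le_of_weightedFlux_le (p := p) (β := 2 * (p - Module.finrank ℝ E)) (by linarith) hDo hDb
      h0 hwD (hv.mono hDΩ) hwc (hv.continuousOn.mono hclΩ) ?_ ?_ x ⟨hx1, hx2⟩
    · intro z hz
      rw [hw']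
      rcases hfr z hz with h | h <;> rw [h]
      exacts [h1 z h, h2 z h]
    · intro φ hφ hc hs _
      rw [hwsol φ hφ hc hs, hsol φ hφ hc (hs.trans hDΩ)]
  · intro h1 h2 x hx1 hx2
    rw [← hw']
    refine le_of_weightedFlux_le (p := p) (β := 2 * (p - Module.finrank ℝ E)) (by linarith) hDo hDb
      h0 (hv.mono hDΩ) hwD (hv.continuousOn.mono hclΩ) hwc ?_ ?_ x ⟨hx1, hx2⟩
    · intro z hz
      rw [hw']
      rcases hfr z hz with h | h <;> rw [h]
      exacts [h1 z h, h2 z h]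
    · intro φ hφ hc hs _
      rw [hwsol φ hφ hc hs, hsol φ hφ hc (hs.trans hDΩ)]

/-- Two-sided bound near an isolated singularity by the singular radial solution. -/
lemma exists_bounds_of_isWeakSolution {p : ℝ} (hE : 2 ≤ Module.finrank ℝ E)
    (hp : (Module.finrank ℝ E : ℝ) < p) {R R' : ℝ} (hRR' : R < R') {v : E → ℝ}
    (hv : ContDiffOn ℝ 1 v (ball (0 : E) R' \ {0}))
    (hsol : IsWeakSolution p (2 * (p - Module.finrank ℝ E)) v (ball (0 : E) R' \ {0}))
    {δ : ℝ} (hδ : 0 < δ) (hδR : δ < R) (hpos : ∀ x : E, 0 < ‖x‖ → ‖x‖ < δ → 0 < v x)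
    (hneg : ∀ x : E, ‖x‖ = R → v x < 0) {α : ℝ}
    (hα : α = (Module.finrank ℝ E - p) / (p - 1)) :
    ∃ c₁ c₂ : ℝ, 0 < c₁ ∧ ∀ x : E, 0 < ‖x‖ → ‖x‖ < δ / 4 →
      c₁ * ‖x‖ ^ α ≤ v x ∧ v x ≤ c₂ * ‖x‖ ^ α := by
  have hn2 : (2 : ℝ) ≤ Module.finrank ℝ E := by exact_mod_cast hE
  have hα0 : α < 0 := by
    rw [hα]
    exact div_neg_of_neg_of_pos (by linarith) (by linarith)
  have hΩ : IsOpen (ball (0 : E) R' \ {0}) := isOpen_ball.sdiff isClosed_singleton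
  have hmem : ∀ x : E, 0 < ‖x‖ → ‖x‖ < R' → x ∈ ball (0 : E) R' \ {0} := fun x h1 h2 ↦
    ⟨by simpa using h2, norm_pos_iff.1 h1⟩
  set γ := (p - Module.finrank ℝ E) / (2 * (p - 1)) with hγ
  have hγ0 : 0 < γ := div_pos (by linarith) (by linarith)
  have hκ : 0 < 1 - (1 / 2 : ℝ) ^ γ :=
    sub_pos.2 (Real.rpow_lt_one (by norm_num) (by norm_num) hγ0)
  set Λ : ℝ := (1 - (1 / 2 : ℝ) ^ γ) ^ 80 with hΛ
  have hΛ0 : 0 < Λ := by positivity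
  have hloc : ∀ x y : E, 0 < ‖y‖ → ‖y‖ < δ / 2 → ‖x - y‖ ≤ ‖y‖ / 10 →
      (1 - (1 / 2 : ℝ) ^ γ) * v y ≤ v x := by
    intro x y hy0 hyδ hxy
    have hball : ∀ z ∈ closedBall y (‖y‖ / 5), 0 < ‖z‖ ∧ ‖z‖ < δ := by
      intro z hz
      rw [mem_closedBall, dist_eq_norm] at hz
      have h1 := norm_sub_norm_le z y
      have h2 := norm_sub_norm_le y z
      rw [norm_sub_rev] at h2
      constructor <;> linarith
    exact harnack_local hE hp hv hsol (norm_pos_iff.1 hy0)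
      (fun z hz ↦ hmem z (hball z hz).1 (by linarith [(hball z hz).2]))
      (fun z hz ↦ hpos z (hball z hz).1 (hball z hz).2) hxy
  have hharnack : ∀ x y : E, ‖x‖ = ‖y‖ → 0 < ‖y‖ → ‖y‖ < δ / 2 → Λ * v y ≤ v x :=
    fun x y h1 h2 h3 ↦ harnack_sphere hE hκ.le hloc h1 h2 h3
  have : Nontrivial E := Module.nontrivial_of_finrank_pos (R := ℝ) (by omega)
  obtain ⟨x₀, hx₀⟩ := exists_norm_eq E (show 0 ≤ δ / 4 by positivity)
  have hvx₀ : 0 < v x₀ := hpos x₀ (by rw [hx₀]; positivity) (by rw [hx₀]; linarith)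
  have hanti : ∀ {s t : ℝ}, 0 < s → s < t → t ^ α < s ^ α := fun hs hst ↦
    Real.rpow_lt_rpow_of_neg hs hst hα0
  set g := (δ / 4) ^ α with hg
  have hg0 : 0 < g := by positivity
  have hg1 : (δ / 2) ^ α < g := hanti (by positivity) (by linarith)
  have hg2 : R ^ α < g := hanti (by positivity) (by linarith)
  refine ⟨Λ / 2 * v x₀ / g, 2 / Λ * v x₀ / (g - (δ / 2) ^ α), by positivity, ?_⟩
  intro x hx0 hxδ
  set ρ := ‖x‖ with hρ
  have hvx : 0 < v x := hpos x hx0 (by linarith)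
  have hρg : g < ρ ^ α := hanti hx0 hxδ
  constructor
  · have hden : 0 < ρ ^ α - R ^ α := by linarith
    set B := 2 * v x / Λ / (ρ ^ α - R ^ α) with hB
    have hB1 : B * (ρ ^ α - R ^ α) = 2 * v x / Λ := div_mul_cancel₀ _ hden.ne'
    have h := (annulus_comparison hE hp hv hsol hx0
      (fun z h1 h2 ↦ hmem z (hx0.trans_le h1) (h2.trans_lt hRR')) (-B * R ^ α) B hα).2 ?_ ?_ x₀
      (by rw [hx₀]; exact hxδ) (by rw [hx₀]; linarith)
    · rw [hx₀, ← hg] at h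
      have h1 : v x₀ ≤ B * (g - R ^ α) := by linarith
      have hRα : 0 < R ^ α := Real.rpow_pos_of_pos (by linarith) _
      exact lower_bound_of_barrier_le hΛ0 hvx₀ hRα hg2 hρg hB1 h1
    · intro z hz
      have h1 := hharnack x z hz.symm (by rw [hz]; exact hx0) (by rw [hz]; linarith)
      have h2 : v z ≤ v x / Λ := by
        rw [le_div_iff₀ hΛ0]
        linarith
      have h3 : 0 < v x / Λ := by positivity
      have h4 : 2 * v x / Λ = 2 * (v x / Λ) := by ring
      linarith
    · intro z hz
      have := hneg z hz
      linarith
  · have hden : 0 < ρ ^ α - (δ / 2) ^ α := by linarith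
    set B := Λ * v x / 2 / (ρ ^ α - (δ / 2) ^ α) with hB
    have hB1 : B * (ρ ^ α - (δ / 2) ^ α) = Λ * v x / 2 := div_mul_cancel₀ _ hden.ne'
    have h := (annulus_comparison hE hp hv hsol hx0 (b := δ / 2)
      (fun z h1 h2 ↦ hmem z (hx0.trans_le h1) (h2.trans_lt (by linarith)))
      (-B * (δ / 2) ^ α) B hα).1 ?_ ?_ x₀
      (by rw [hx₀]; exact hxδ) (by rw [hx₀]; linarith)
    · rw [hx₀, ← hg] at h
      have h1 : B * (g - (δ / 2) ^ α) ≤ v x₀ := by linarith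
      have hδα : 0 < (δ / 2) ^ α := by positivity
      exact upper_bound_of_barrier_le hΛ0 hvx₀ hδα hg1 hρg hB1 h1
    · intro z hz
      have h1 := hharnack z x hz hx0 (by linarith)
      have h3 : 0 < Λ * v x := by positivity
      linarith
    · intro z hz
      have := hpos z (by rw [hz]; positivity) (by rw [hz]; linarith)
      linarith

end Harnack

theorem stmt19 (d : ℕ) (hd : 2 ≤ d) (p : ℝ) (hpd : (d : ℝ) < p)
    (R R' : ℝ) (hR : 0 < R) (hRR' : R < R')
    (v : EuclideanSpace ℝ (Fin d) → ℝ)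
    (hv1 : ContDiffOn ℝ 1 v (ball (0 : EuclideanSpace ℝ (Fin d)) R' \ {0}))
    -- weak solution of the weighted equation with weight ‖x‖ ^ (2*(p-d))
    (hsol : ∀ φ : EuclideanSpace ℝ (Fin d) → ℝ, ContDiff ℝ (⊤ : ℕ∞) φ → HasCompactSupport φ →
      tsupport φ ⊆ ball (0 : EuclideanSpace ℝ (Fin d)) R' \ {0} →
      ∫ x in ball (0 : EuclideanSpace ℝ (Fin d)) R' \ {0},
        ‖x‖ ^ (2 * (p - d)) * ‖gradient v x‖ ^ (p - 2) * ⟪gradient v x, gradient φ x⟫ = 0)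
    -- v blows up at the origin
    (hblow : Tendsto v (𝓝[ball (0 : EuclideanSpace ℝ (Fin d)) R' \ {0}] 0) atTop)
    -- v is positive near the origin
    (hpos : ∃ δ : ℝ, 0 < δ ∧ δ < R ∧
      ∀ x : EuclideanSpace ℝ (Fin d), 0 < ‖x‖ → ‖x‖ < δ → 0 < v x)
    -- v is negative on the sphere of radius R
    (hneg : ∀ x : EuclideanSpace ℝ (Fin d), ‖x‖ = R → v x < 0) :
    ∃ ε : ℝ, 0 < ε ∧ ε < R ∧ ∃ C : ℝ, 1 ≤ C ∧
      ∀ x : EuclideanSpace ℝ (Fin d), 0 < ‖x‖ → ‖x‖ < ε →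
        C⁻¹ * ‖x‖ ^ (((d : ℝ) - p) / (p - 1)) ≤ v x ∧
        v x ≤ C * ‖x‖ ^ (((d : ℝ) - p) / (p - 1)) := by
  obtain ⟨δ, hδ, hδR, hpos⟩ := hpos
  have hfin : Module.finrank ℝ (EuclideanSpace ℝ (Fin d)) = d := finrank_euclideanSpace_fin
  have hd2 : (2 : ℝ) ≤ d := by exact_mod_cast hd
  have hΩ : IsOpen (ball (0 : EuclideanSpace ℝ (Fin d)) R' \ {0}) :=
    isOpen_ball.sdiff isClosed_singleton
  have hweak : IsWeakSolution p (2 * (p - d)) v (ball (0 : EuclideanSpace ℝ (Fin d)) R' \ {0}) := by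
    intro φ hφ hc hs
    refine integral_fderiv_apply_eq_zero_of_contDiff_one hΩ
      (continuousOn_weightedFlux (by linarith) hΩ (fun h ↦ h.2 rfl) hv1) ?_ hφ hc hs
    intro φ hφ hc hs
    rw [← hsol φ hφ hc hs, setIntegral_eq_integral_of_forall_compl_eq_zero]
    · refine integral_congr_ae (Eventually.of_forall fun x ↦ ?_)
      simp only [fderiv_apply_eq_inner_gradient, weightedFlux, real_inner_smul_right,
        real_inner_comm (gradient v x)]
    · intro x hx
      have h : gradient φ x = 0 := by
        rw [gradient, image_eq_zero_of_notMem_tsupport fun h ↦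
          hx (hs (tsupport_fderiv_subset ℝ h)), map_zero]
      rw [h, inner_zero_right, mul_zero]
  obtain ⟨c₁, c₂, hc₁, h⟩ := exists_bounds_of_isWeakSolution (by rwa [hfin]) (by rwa [hfin]) hRR'
    hv1 (by rwa [hfin]) hδ hδR hpos hneg (α := ((d : ℝ) - p) / (p - 1)) (by rw [hfin])
  refine ⟨δ / 4, by positivity, by linarith, max 1 (max c₁⁻¹ c₂), le_max_left _ _, ?_⟩
  intro x hx0 hxδ
  obtain ⟨h1, h2⟩ := h x hx0 hxδ
  have hα : 0 ≤ ‖x‖ ^ (((d : ℝ) - p) / (p - 1)) := by positivity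
  constructor
  · refine le_trans (mul_le_mul_of_nonneg_right ?_ hα) h1
    exact inv_le_of_inv_le₀ hc₁ ((le_max_left _ _).trans (le_max_right _ _))
  · exact h2.trans (mul_le_mul_of_nonneg_right ((le_max_right _ _).trans (le_max_right _ _)) hα)
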